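/- arXiv:math/0608681 — 2 statements merged into one kernel-verified Lean document; each statement's English description precedes it below -/
import Mathlib

section
/- Let F satisfy assumptions A1), A2), and A4). Then there exists x₀ > 0 such that for every x ≥ x₀ one has Φ(x) ≤ F^{−1}(1 + x), where F^{−1} is the inverse of F on the range where F is increasing to infinity. -/
open MeasureTheory Real Set Filter
open scoped ENNReal

noncomputable section

/-- The surface measure (lower Minkowski content) `μ⁺(A)` of a set `A`:
`liminf_{h→0⁺} (μ(A^h) − μ(A))/h`, where `A^h = {x : dist(x,A) ≤ h}`. -/
def surfaceMeasure {d : ℕ} (μ : Measure (EuclideanSpace ℝ (Fin d)))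
    (A : Set (EuclideanSpace ℝ (Fin d))) : ℝ :=
  liminf (fun h : ℝ =>
    ((μ (Metric.cthickening h A)).toReal - (μ A).toReal) / h) (nhdsWithin 0 (Ioi 0))

/-- `I_F(r) = sup { μ(A) F(1/μ(A)) / μ⁺(A) : A Borel, μ(A) = 1 − μ(B_r) }`. -/
def isoF {d : ℕ} (μ : Measure (EuclideanSpace ℝ (Fin d))) (F : ℝ → ℝ) (r : ℝ) : ℝ :=
  sSup { z | ∃ A : Set (EuclideanSpace ℝ (Fin d)), MeasurableSet A ∧
    (μ A).toReal = 1 - (μ (Metric.closedBall 0 r)).toReal ∧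
    z = (μ A).toReal * F (1 / (μ A).toReal) / surfaceMeasure μ A }

/-- The isoperimetric function `𝓘_μ(t) = inf { μ⁺(A) : A Borel, μ(A) = t }`. -/
def isoProfile {d : ℕ} (μ : Measure (EuclideanSpace ℝ (Fin d))) (t : ℝ) : ℝ :=
  sInf { z | ∃ A : Set (EuclideanSpace ℝ (Fin d)), MeasurableSet A ∧
    (μ A).toReal = t ∧ z = surfaceMeasure μ A }

/-- The Legendre transform over `[0, ∞)`: `c*(x) = sup_{y ≥ 0} (xy − c(y))`. -/
def legendre (c : ℝ → ℝ) (x : ℝ) : ℝ :=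
  sSup { z | ∃ y : ℝ, 0 ≤ y ∧ z = x * y - c y }

/-- `Φ(x) = (yF(y) − y)^*(x) = sup_{y > 0} (xy − yF(y) + y)`. -/
def PhiF (F : ℝ → ℝ) (x : ℝ) : ℝ :=
  sSup { z | ∃ y : ℝ, 0 < y ∧ z = x * y - y * F y + y }

/-- The topological support of a measure. -/
def msupport {d : ℕ} (μ : Measure (EuclideanSpace ℝ (Fin d))) :
    Set (EuclideanSpace ℝ (Fin d)) :=
  { x | ∀ U : Set (EuclideanSpace ℝ (Fin d)), IsOpen U → x ∈ U → 0 < μ U }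

/-- A convex (log-concave) measure: `μ = e^{-V} dx` for a convex `V : ℝ^d → ℝ ∪ {+∞}`,
encoded by a finite convex function `V` on a convex domain `s` (with `V = +∞`,
i.e. density `0`, outside `s`). -/
def IsConvexMeasure {d : ℕ} (μ : Measure (EuclideanSpace ℝ (Fin d))) : Prop :=
  ∃ (s : Set (EuclideanSpace ℝ (Fin d))) (V : EuclideanSpace ℝ (Fin d) → ℝ),
    Convex ℝ s ∧ ConvexOn ℝ s V ∧
    μ = volume.withDensity (s.indicator (fun x => ENNReal.ofReal (exp (-V x))))

/-- `Ent_μ g = ∫ g log (g / ∫ g dμ) dμ`. -/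
def entropy {α : Type*} [MeasurableSpace α] (μ : Measure α) (g : α → ℝ) : ℝ :=
  ∫ x, g x * log (g x / ∫ y, g y ∂μ) ∂μ

/-- `Var_μ f = ∫ f² dμ − (∫ f dμ)²`. -/
def var {α : Type*} [MeasurableSpace α] (μ : Measure α) (f : α → ℝ) : ℝ :=
  (∫ x, f x ^ 2 ∂μ) - (∫ x, f x ∂μ) ^ 2

/-- The cost function `c_{A,q}`. -/
def cA (A q x : ℝ) : ℝ :=
  if |x| ≤ A then x ^ 2 / 2 else A ^ (2 - q) * |x| ^ q / q + A ^ 2 * (q - 2) / (2 * q)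

/-- The perturbation function `ψ_{τ,β}`. -/
def psi (τ β x : ℝ) : ℝ :=
  if x ≤ 1 then x else β / 2 * ((1 + τ * (x - 1)) ^ (2 / (τ * β)) - 1) + 1

/-- The median `m_f = inf {t : μ(f > t) ≤ 1/2}`. -/
def median {α : Type*} [MeasurableSpace α] (μ : Measure α) (f : α → ℝ) : ℝ :=
  sInf { t : ℝ | μ { x | t < f x } ≤ 1/2 }

/-- The generalized entropy function `F_τ` built from `φ` (with `φ(x₀) = 1`). -/
def Ftau (φ : ℝ → ℝ) (x₀ τ x : ℝ) : ℝ :=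
  if x ≤ x₀ then φ x else (φ x ^ τ - 1) / τ + 1

end

/-- A monotone function on a half-line is differentiable at some interior point. -/
theorem exists_differentiableAt_of_monotoneOn_Ioi {f : ℝ → ℝ} {a : ℝ}
    (hf : MonotoneOn f (Ioi a)) : ∃ x, a < x ∧ DifferentiableAt ℝ f x := by
  have h := hf.ae_differentiableWithinAt measurableSet_Ioi
  have hne : (ae (volume.restrict (Ioi a))).NeBot := by
    rw [ae_neBot, Ne, Measure.restrict_eq_zero]
    simp
  obtain ⟨x, hx, hxa⟩ := (h.and (ae_restrict_mem measurableSet_Ioi)).exists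
  exact ⟨x, hxa, hx.differentiableAt (Ioi_mem_nhds hxa)⟩

/-- If `F` is concave and strictly increasing and `y F'(y)` is antitone and at most `1` beyond
`y₀`, then the chords of `F` to the right of `y ≥ y₀` have slope at most `1 / y`. -/
theorem mul_sub_le_sub_of_antitoneOn_mul_deriv {F : ℝ → ℝ} {y₀ : ℝ}
    (hconc : ConcaveOn ℝ (Ioi 0) F) (hmono : StrictMonoOn F (Ioi 0)) (hy₀ : 0 < y₀)
    (hanti : AntitoneOn (fun y => y * deriv F y) (Ici y₀))
    (hle : ∀ y ∈ Ici y₀, y * deriv F y ≤ 1) {y z : ℝ} (hy : y₀ ≤ y) (hyz : y < z) :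
    y * (F z - F y) ≤ z - y := by
  have chord : ∀ u v : ℝ, 0 < u → u < v → DifferentiableAt ℝ F u →
      F v - F u ≤ deriv F u * (v - u) := by
    intro u v hu huv hd
    have := hconc.slope_le_deriv (mem_Ioi.2 hu) (mem_Ioi.2 (hu.trans huv)) huv hd
    rwa [slope_def_field, div_le_iff₀ (sub_pos.2 huv)] at this
  have hy0 : 0 < y := hy₀.trans_le hy
  have hd : DifferentiableAt ℝ F y := by
    by_contra hnd
    obtain ⟨w, hyw, hw⟩ := exists_differentiableAt_of_monotoneOn_Ioi
      (hmono.monotoneOn.mono (Ioi_subset_Ioi hy0.le))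
    have hw0 : 0 < w := hy0.trans hyw
    have h1 : w * deriv F w ≤ y * deriv F y := hanti hy (hy.trans hyw.le) hyw.le
    rw [deriv_zero_of_not_differentiableAt hnd, mul_zero] at h1
    have h2 : deriv F w ≤ 0 := nonpos_of_mul_nonpos_right h1 hw0
    have h3 := chord w (w + 1) hw0 (by linarith) hw
    have h4 := hmono (mem_Ioi.2 hw0) (mem_Ioi.2 (by linarith : 0 < w + 1)) (by linarith)
    linarith
  calc y * (F z - F y) ≤ y * (deriv F y * (z - y)) :=
        mul_le_mul_of_nonneg_left (chord y z hy0 hyz hd) hy0.le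
    _ = (y * deriv F y) * (z - y) := by ring
    _ ≤ 1 * (z - y) := mul_le_mul_of_nonneg_right (hle y hy) (sub_nonneg.2 hyz.le)
    _ = z - y := one_mul _

/-- If `F` is increasing on `(0, ∞)` and `y F(y) → 0` at `0⁺`, then `y F(y)` is bounded below on
every bounded interval `(0, b]`. -/
theorem exists_neg_le_mul_of_tendsto_zero {F : ℝ → ℝ} (hmono : MonotoneOn F (Ioi 0))
    (hzero : Tendsto (fun y => y * F y) (nhdsWithin 0 (Ioi 0)) (nhds 0)) (b : ℝ) :
    ∃ B : ℝ, ∀ y, 0 < y → y ≤ b → -B ≤ y * F y := by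
  obtain ⟨δ, hδ, hδ'⟩ := mem_nhdsGT_iff_exists_Ioo_subset.1
    (hzero.eventually (lt_mem_nhds (show (-1 : ℝ) < 0 by norm_num)))
  have hδ0 : 0 < δ := hδ
  refine ⟨1 + b * |F δ|, fun y hy hyb => ?_⟩
  have hb : 0 ≤ b * |F δ| := mul_nonneg (hy.le.trans hyb) (abs_nonneg _)
  rcases lt_or_ge y δ with h | h
  · have : -1 < y * F y := hδ' ⟨hy, h⟩
    linarith
  · have h1 : y * F δ ≤ y * F y := mul_le_mul_of_nonneg_left (hmono hδ hy h) hy.le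
    have h2 : y * -|F δ| ≤ y * F δ := mul_le_mul_of_nonneg_left (neg_abs_le _) hy.le
    have h3 : y * |F δ| ≤ b * |F δ| := mul_le_mul_of_nonneg_right hyb (abs_nonneg _)
    linarith

theorem stmt10 (F : ℝ → ℝ) (hA1_conc : ConcaveOn ℝ (Ioi 0) F) (hA1_mono : StrictMonoOn F (Ioi 0))
    (hA1_one : F 1 = 0)
    (hA2_zero : Tendsto (fun y => y * F y) (nhdsWithin 0 (Ioi 0)) (nhds 0))
    (hA2_top : Tendsto F atTop atTop)
    (hA4 : ∃ y₀ : ℝ, 1 ≤ y₀ ∧ AntitoneOn (fun y => y * deriv F y) (Ici y₀) ∧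
      ∀ y ∈ Ici y₀, y * deriv F y ≤ 1) :
    ∃ x₀ : ℝ, 0 < x₀ ∧ ∀ x : ℝ, x₀ ≤ x →
      PhiF F x ≤ Function.invFunOn F (Ioi 0) (1 + x) := by
  obtain ⟨y₀, hy₀, hanti, hle⟩ := hA4
  have hy₀' : 0 < y₀ := by linarith
  obtain ⟨B, hB⟩ := exists_neg_le_mul_of_tendsto_zero hA1_mono.monotoneOn hA2_zero y₀
  set K := 2 * y₀ with hK
  set Z := max (K + 1) (2 * (B + y₀ * F K)) with hZ
  have hZ0 : 0 < Z := lt_of_lt_of_le (by linarith) (le_max_left _ _)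
  refine ⟨max 1 (F Z), lt_of_lt_of_le one_pos (le_max_left _ _), fun x hx => ?_⟩
  have hx1 : 1 ≤ x := (le_max_left _ _).trans hx
  have hxZ : F Z ≤ x := (le_max_right _ _).trans hx
  have hex : ∃ a ∈ Ioi (0 : ℝ), F a = 1 + x := by
    obtain ⟨M, hM1, hM⟩ :=
      ((eventually_ge_atTop (1 : ℝ)).and (hA2_top.eventually_ge_atTop (1 + x))).exists
    have hcont : ContinuousOn F (Icc 1 M) :=
      (hA1_conc.continuousOn isOpen_Ioi).mono fun t ht => lt_of_lt_of_le one_pos ht.1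
    obtain ⟨a, ha, hFa⟩ := intermediate_value_Icc hM1 hcont
      (show 1 + x ∈ Icc (F 1) (F M) from ⟨by linarith, hM⟩)
    exact ⟨a, lt_of_lt_of_le one_pos ha.1, hFa⟩
  have hz0 : 0 < Function.invFunOn F (Ioi 0) (1 + x) := Function.invFunOn_mem hex
  have hFz : F (Function.invFunOn F (Ioi 0) (1 + x)) = 1 + x := Function.invFunOn_eq hex
  generalize Function.invFunOn F (Ioi 0) (1 + x) = z at hz0 hFz
  have hZz : Z < z := (hA1_mono.lt_iff_lt hZ0 hz0).1 (by linarith)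
  have hKz : K < z := by linarith [le_max_left (K + 1) (2 * (B + y₀ * F K))]
  have hBz : 2 * (B + y₀ * F K) ≤ z := (le_max_right _ _).trans hZz.le
  refine csSup_le ⟨_, 1, one_pos, rfl⟩ ?_
  rintro _ ⟨y, hy, rfl⟩
  suffices y * (F z - F y) ≤ z by
    rw [hFz] at this
    linarith
  rcases le_or_gt z y with hzy | hyz
  · have h1 : F z ≤ F y := hA1_mono.monotoneOn hz0 hy hzy
    exact (mul_nonpos_of_nonneg_of_nonpos hy.le (sub_nonpos.2 h1)).trans hz0.le
  rcases le_or_gt y₀ y with hyy | hyy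
  · have := mul_sub_le_sub_of_antitoneOn_mul_deriv hA1_conc hA1_mono hy₀' hanti hle hyy hyz
    linarith
  · have h1 := mul_sub_le_sub_of_antitoneOn_mul_deriv hA1_conc hA1_mono hy₀' hanti hle
      (show y₀ ≤ K by linarith) hKz
    have h2 : y * F z ≤ y₀ * F z :=
      mul_le_mul_of_nonneg_right hyy.le (by linarith)
    have h3 := hB y hy hyy.le
    have h4 : K * (F z - F K) = 2 * (y₀ * F z) - 2 * (y₀ * F K) := by rw [hK]; ring
    linarith
end

section
/- Let μ be a convex (log-concave) probability measure on ℝ^d whose support contains 0, and let I_log(r) = sup{ μ(A) log(1/μ(A)) / μ⁺(A) : A Borel with μ(A) = 1 − μ(B_r) }. Then sup_{r ≥ R_{1/2}} I_log(r)/r < ∞, where R_{1/2} is defined by μ(B_{R_{1/2}}) = 1/2. -/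
open MeasureTheory Real Set Filter
open scoped ENNReal

/-- The **one-dimensional Brunn–Minkowski inequality**. -/
theorem volume_add_volume_le_of_add_mem {A B S : Set ℝ} (hA : MeasurableSet A)
    (hB : MeasurableSet B) (hA₀ : A.Nonempty) (hB₀ : B.Nonempty)
    (h : ∀ a ∈ A, ∀ b ∈ B, a + b ∈ S) : volume A + volume B ≤ volume S := by
  have compact_case : ∀ K L : Set ℝ, IsCompact K → IsCompact L → K.Nonempty → L.Nonempty →
      K ⊆ A → L ⊆ B → volume K + volume L ≤ volume S := by
    intro K L hK hL hK₀ hL₀ hKA hLB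
    obtain ⟨a, haK, ha⟩ := hK.exists_isGreatest hK₀
    obtain ⟨b, hbL, hb⟩ := hL.exists_isLeast hL₀
    have hL' : IsCompact ((fun x => a + x) '' L) := hL.image (by fun_prop)
    have hdisj : AEDisjoint volume ((fun x => b + x) '' K) ((fun x => a + x) '' L) := by
      refine measure_mono_null (t := {a + b}) ?_ (by simp)
      rintro _ ⟨⟨x, hx, rfl⟩, ⟨y, hy, hxy⟩⟩
      have h₁ := ha hx
      have h₂ := hb hy
      simp only at hxy
      simp only [mem_singleton_iff]
      linarith
    have hunion := measure_union₀ hL'.measurableSet.nullMeasurableSet hdisj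
    have hK_eq : volume ((fun x => b + x) '' K) = volume K := by simp
    have hL_eq : volume ((fun x => a + x) '' L) = volume L := by simp
    rw [hK_eq, hL_eq] at hunion
    rw [← hunion]
    refine measure_mono (union_subset ?_ ?_)
    · rintro _ ⟨x, hx, rfl⟩
      simpa [add_comm] using h x (hKA hx) b (hLB hbL)
    · rintro _ ⟨x, hx, rfl⟩
      exact h a (hKA haK) x (hLB hx)
  obtain ⟨a, ha⟩ := hA₀
  obtain ⟨b, hb⟩ := hB₀
  rw [hA.measure_eq_iSup_isCompact, hB.measure_eq_iSup_isCompact]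
  simp only [iSup_and']
  refine ENNReal.biSup_add_biSup_le' ⟨∅, by simp⟩ ⟨∅, by simp⟩ fun K hK L hL => ?_
  calc volume K + volume L ≤ volume (insert a K) + volume (insert b L) := by
        gcongr <;> exact subset_insert _ _
    _ ≤ volume S := compact_case _ _ (hK.2.insert a) (hL.2.insert b) (insert_nonempty _ _)
        (insert_nonempty _ _) (insert_subset ha hK.1) (insert_subset hb hL.1)

theorem lintegral_eq_lintegral_volume_lt {f : ℝ → ℝ≥0∞} (hf : Measurable f) (hf₁ : ∀ x, f x ≤ 1) :
    ∫⁻ x, f x = ∫⁻ u in Ioi (0 : ℝ), volume {x | ENNReal.ofReal u < f x} := by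
  have hfin : ∀ x, f x ≠ ∞ := fun x => ne_top_of_le_ne_top ENNReal.one_ne_top (hf₁ x)
  have key := lintegral_eq_lintegral_meas_lt (volume : Measure ℝ) (f := fun x => (f x).toReal)
    (.of_forall fun x => ENNReal.toReal_nonneg) hf.ennreal_toReal.aemeasurable
  simp only [ENNReal.ofReal_toReal (hfin _)] at key
  rw [key]
  refine setLIntegral_congr_fun measurableSet_Ioi fun u hu => ?_
  simp only [ENNReal.ofReal_lt_iff_lt_toReal (le_of_lt hu) (hfin _)]

open scoped Pointwise in
theorem add_lintegral_le_of_iSup_eq_one {f g w : ℝ → ℝ≥0∞} (hf : Measurable f)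
    (hg : Measurable g) (hw : Measurable w) (hf₁ : ⨆ x, f x = 1) (hg₁ : ⨆ x, g x = 1)
    {t s : ℝ} (ht : 0 < t) (hs : 0 < s) (hts : t + s = 1)
    (h : ∀ x y, f x ^ t * g y ^ s ≤ w (t * x + s * y)) :
    ENNReal.ofReal t * (∫⁻ x, f x) + ENNReal.ofReal s * ∫⁻ x, g x ≤ ∫⁻ x, w x := by
  have hf_le : ∀ x, f x ≤ 1 := fun x => hf₁ ▸ le_iSup f x
  have hg_le : ∀ x, g x ≤ 1 := fun x => hg₁ ▸ le_iSup g x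
  calc _ ≤ ∫⁻ x, min (w x) 1 := ?_
    _ ≤ _ := lintegral_mono fun x => min_le_left _ _
  rw [lintegral_eq_lintegral_volume_lt hf hf_le, lintegral_eq_lintegral_volume_lt hg hg_le,
    lintegral_eq_lintegral_volume_lt (hw.min measurable_const) fun x => min_le_right _ _,
    ← lintegral_const_mul' _ _ ENNReal.ofReal_ne_top,
    ← lintegral_const_mul' _ _ ENNReal.ofReal_ne_top]
  refine (le_lintegral_add _ _).trans (setLIntegral_mono' measurableSet_Ioi fun u hu => ?_)
  have hu₀ : 0 < u := hu
  rcases le_or_gt 1 u with hu₁ | hu₁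
  · have hempty : ∀ k : ℝ → ℝ≥0∞, (∀ x, k x ≤ 1) → {x | ENNReal.ofReal u < k x} = ∅ := by
      intro k hk
      ext x
      simpa using (hk x).trans (by simpa using hu₁)
    simp [hempty f hf_le, hempty g hg_le]
  have hu_lt : ENNReal.ofReal u < 1 := by simpa using hu₁
  obtain ⟨x₀, hx₀⟩ := lt_iSup_iff.1 (hf₁.symm ▸ hu_lt)
  obtain ⟨y₀, hy₀⟩ := lt_iSup_iff.1 (hg₁.symm ▸ hu_lt)
  have hmf : MeasurableSet {x | ENNReal.ofReal u < f x} := measurableSet_lt measurable_const hf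
  have hmg : MeasurableSet {x | ENNReal.ofReal u < g x} := measurableSet_lt measurable_const hg
  have hscale : ∀ {c : ℝ}, 0 < c → ∀ A : Set ℝ, ENNReal.ofReal c * volume A = volume (c • A) := by
    intro c hc A
    simp [Measure.addHaar_smul, abs_of_pos hc]
  rw [hscale ht, hscale hs]
  refine volume_add_volume_le_of_add_mem (hmf.const_smul₀ t) (hmg.const_smul₀ s)
    (Set.Nonempty.smul_set ⟨x₀, hx₀⟩) (Set.Nonempty.smul_set ⟨y₀, hy₀⟩) ?_
  rintro _ ⟨x, hx, rfl⟩ _ ⟨y, hy, rfl⟩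
  refine lt_min (lt_of_lt_of_le ?_ (h x y)) hu_lt
  calc ENNReal.ofReal u = ENNReal.ofReal u ^ t * ENNReal.ofReal u ^ s := by
        rw [← ENNReal.rpow_add _ _ (by simpa using hu₀) ENNReal.ofReal_ne_top, hts,
          ENNReal.rpow_one]
    _ < f x ^ t * g y ^ s :=
        ENNReal.mul_lt_mul (ENNReal.rpow_lt_rpow hx ht) (ENNReal.rpow_lt_rpow hy hs)

theorem ennreal_geom_mean_le_arith_mean {t s : ℝ} (ht : 0 < t) (hs : 0 < s) (hts : t + s = 1)
    (a b : ℝ≥0∞) : a ^ t * b ^ s ≤ ENNReal.ofReal t * a + ENNReal.ofReal s * b := by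
  rcases eq_or_ne a ∞ with rfl | ha
  · simp [ENNReal.mul_top, ht]
  rcases eq_or_ne b ∞ with rfl | hb
  · simp [ENNReal.mul_top, hs]
  lift a to NNReal using ha
  lift b to NNReal using hb
  have := NNReal.geom_mean_le_arith_mean2_weighted t.toNNReal s.toNNReal a b
    (by rw [← Real.toNNReal_add ht.le hs.le, hts, Real.toNNReal_one])
  rw [Real.coe_toNNReal _ ht.le, Real.coe_toNNReal _ hs.le] at this
  rw [← ENNReal.coe_rpow_of_nonneg _ ht.le, ← ENNReal.coe_rpow_of_nonneg _ hs.le]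
  unfold ENNReal.ofReal
  exact_mod_cast this

/-- The Prékopa–Leindler inequality, as a property of a measure on a real vector space. -/
def PrekopaLeindler {E : Type*} [AddCommGroup E] [Module ℝ E] [MeasurableSpace E]
    (μ : Measure E) : Prop :=
  ∀ f g w : E → ℝ≥0∞, Measurable f → Measurable g → Measurable w →
    ∀ t s : ℝ, 0 < t → 0 < s → t + s = 1 →
    (∀ x y, f x ^ t * g y ^ s ≤ w (t • x + s • y)) →
    (∫⁻ x, f x ∂μ) ^ t * (∫⁻ x, g x ∂μ) ^ s ≤ ∫⁻ x, w x ∂μ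

theorem prekopaLeindler_real_of_bounded {f g w : ℝ → ℝ≥0∞} (hf : Measurable f)
    (hg : Measurable g) (hw : Measurable w) (hf_bdd : ⨆ x, f x ≠ ∞) (hg_bdd : ⨆ x, g x ≠ ∞)
    {t s : ℝ} (ht : 0 < t) (hs : 0 < s) (hts : t + s = 1)
    (h : ∀ x y, f x ^ t * g y ^ s ≤ w (t * x + s * y)) :
    (∫⁻ x, f x) ^ t * (∫⁻ x, g x) ^ s ≤ ∫⁻ x, w x := by
  set a := ⨆ x, f x with ha
  set b := ⨆ x, g x with hb
  rcases eq_or_ne a 0 with ha₀ | ha₀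
  · have : ∀ x, f x = 0 := ENNReal.iSup_eq_zero.1 (ha ▸ ha₀)
    simp [this, ht]
  rcases eq_or_ne b 0 with hb₀ | hb₀
  · have : ∀ x, g x = 0 := ENNReal.iSup_eq_zero.1 (hb ▸ hb₀)
    simp [this, hs]
  set c := a ^ t * b ^ s with hc
  have hat₀ : a ^ t ≠ 0 := by simp [ht, ha₀, hf_bdd]
  have hbs₀ : b ^ s ≠ 0 := by simp [hs, hb₀, hg_bdd]
  have hat : a ^ t ≠ ∞ := ENNReal.rpow_ne_top_of_nonneg ht.le hf_bdd
  have hbs : b ^ s ≠ ∞ := ENNReal.rpow_ne_top_of_nonneg hs.le hg_bdd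
  have hc₀ : c ≠ 0 := mul_ne_zero hat₀ hbs₀
  have hc_top : c ≠ ∞ := ENNReal.mul_ne_top hat hbs
  have hcinv : c⁻¹ = a⁻¹ ^ t * b⁻¹ ^ s := by
    rw [hc, ENNReal.mul_inv (.inl hat₀) (.inl hat), ENNReal.inv_rpow, ENNReal.inv_rpow]
  have key := add_lintegral_le_of_iSup_eq_one (f := fun x => a⁻¹ * f x) (g := fun x => b⁻¹ * g x)
    (w := fun x => c⁻¹ * w x) (hf.const_mul _) (hg.const_mul _) (hw.const_mul _)
    (by rw [← ENNReal.mul_iSup, ← ha, ENNReal.inv_mul_cancel ha₀ hf_bdd])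
    (by rw [← ENNReal.mul_iSup, ← hb, ENNReal.inv_mul_cancel hb₀ hg_bdd]) ht hs hts
    (fun x y => by
      rw [ENNReal.mul_rpow_of_nonneg _ _ ht.le, ENNReal.mul_rpow_of_nonneg _ _ hs.le,
        mul_mul_mul_comm, ← hcinv]
      gcongr
      exact h x y)
  have := (ennreal_geom_mean_le_arith_mean ht hs hts _ _).trans key
  rw [lintegral_const_mul _ hf, lintegral_const_mul _ hg, lintegral_const_mul _ hw,
    ENNReal.mul_rpow_of_nonneg _ _ ht.le, ENNReal.mul_rpow_of_nonneg _ _ hs.le,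
    mul_mul_mul_comm, ← hcinv] at this
  exact (ENNReal.mul_le_mul_iff_right (ENNReal.inv_ne_zero.2 hc_top)
    (ENNReal.inv_ne_top.2 hc₀)).1 this

theorem tendsto_lintegral_min_natCast {α : Type*} [MeasurableSpace α] (μ : Measure α)
    {f : α → ℝ≥0∞} (hf : Measurable f) :
    Tendsto (fun n : ℕ => ∫⁻ x, min (f x) n ∂μ) atTop (nhds (∫⁻ x, f x ∂μ)) := by
  refine lintegral_tendsto_of_tendsto_of_monotone
    (fun n => (hf.min measurable_const).aemeasurable)
    (.of_forall fun x m n hmn => min_le_min_left _ (by exact_mod_cast hmn))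
    (.of_forall fun x => ?_)
  simpa using (tendsto_const_nhds (x := f x)).min ENNReal.tendsto_nat_nhds_top

theorem prekopaLeindler_real : PrekopaLeindler (volume : Measure ℝ) := by
  intro f g w hf hg hw t s ht hs hts h
  rcases eq_or_ne (∫⁻ x, f x) 0 with hf₀ | hf₀
  · simp [hf₀, ht]
  rcases eq_or_ne (∫⁻ x, g x) 0 with hg₀ | hg₀
  · simp [hg₀, hs]
  have hbdd : ∀ (k : ℝ → ℝ≥0∞) (n : ℕ), ⨆ x, min (k x) n ≠ ∞ := fun k n =>
    ne_top_of_le_ne_top (ENNReal.natCast_ne_top n) (iSup_le fun x => min_le_right _ _)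
  refine le_of_tendsto (ENNReal.Tendsto.mul
    ((ENNReal.continuous_rpow_const.tendsto _).comp (tendsto_lintegral_min_natCast volume hf))
    (.inl ?_)
    ((ENNReal.continuous_rpow_const.tendsto _).comp (tendsto_lintegral_min_natCast volume hg))
    (.inl ?_)) (.of_forall fun n => prekopaLeindler_real_of_bounded (hf.min measurable_const)
      (hg.min measurable_const) hw (hbdd f n) (hbdd g n) ht hs hts fun x y => ?_)
  · simp [hf₀, ht, ht.not_gt]
  · simp [hg₀, hs, hs.not_gt]
  · refine le_trans ?_ (h x y)
    gcongr <;> exact min_le_left _ _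

theorem PrekopaLeindler.prod {E F : Type*} [AddCommGroup E] [Module ℝ E] [MeasurableSpace E]
    [AddCommGroup F] [Module ℝ F] [MeasurableSpace F] {μ : Measure E} {ν : Measure F} [SFinite ν]
    (hμ : PrekopaLeindler μ) (hν : PrekopaLeindler ν) : PrekopaLeindler (μ.prod ν) := by
  intro f g w hf hg hw t s ht hs hts h
  rw [lintegral_prod _ hf.aemeasurable, lintegral_prod _ hg.aemeasurable,
    lintegral_prod _ hw.aemeasurable]
  exact hμ _ _ _ hf.lintegral_prod_right' hg.lintegral_prod_right' hw.lintegral_prod_right'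
    t s ht hs hts fun x x' => hν _ _ _ (hf.comp measurable_prodMk_left)
      (hg.comp measurable_prodMk_left) (hw.comp measurable_prodMk_left) t s ht hs hts
      fun y y' => h (x, y) (x', y')

theorem PrekopaLeindler.of_measurePreserving {E F : Type*} [AddCommGroup E] [Module ℝ E]
    [MeasurableSpace E] [AddCommGroup F] [Module ℝ F] [MeasurableSpace F] {μ : Measure E}
    {ν : Measure F} (hμ : PrekopaLeindler μ) (e : E →ₗ[ℝ] F) (he : MeasurePreserving e μ ν) :
    PrekopaLeindler ν := by
  intro f g w hf hg hw t s ht hs hts h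
  rw [← he.lintegral_comp hf, ← he.lintegral_comp hg, ← he.lintegral_comp hw]
  refine hμ _ _ _ (hf.comp he.measurable) (hg.comp he.measurable) (hw.comp he.measurable)
    t s ht hs hts fun x y => ?_
  simpa using h (e x) (e y)

theorem prekopaLeindler_pi (n : ℕ) : PrekopaLeindler (volume : Measure (Fin n → ℝ)) := by
  induction n with
  | zero =>
    intro f g w hf hg hw t s ht hs hts h
    have hval : ∀ k : (Fin 0 → ℝ) → ℝ≥0∞, ∫⁻ x, k x = k default := fun k => by
      rw [lintegral_unique, volume_pi, Measure.pi_empty_univ, mul_one]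
      exact congrArg k (Subsingleton.elim _ _)
    rw [hval, hval, hval]
    exact (h default default).trans_eq (congrArg w (Subsingleton.elim _ _))
  | succ n ih =>
    let e : (ℝ × (Fin n → ℝ)) →ₗ[ℝ] (Fin (n + 1) → ℝ) :=
      { toFun := fun p => Fin.cons p.1 p.2
        map_add' := fun p q => by
          ext i
          refine Fin.cases ?_ (fun j => ?_) i <;> simp
        map_smul' := fun c p => by
          ext i
          refine Fin.cases ?_ (fun j => ?_) i <;> simp }
    refine (prekopaLeindler_real.prod ih).of_measurePreserving e ?_
    simpa using! (volume_preserving_piFinSuccAbove (fun _ : Fin (n + 1) => ℝ) 0).symm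

theorem prekopaLeindler_euclideanSpace (d : ℕ) :
    PrekopaLeindler (volume : Measure (EuclideanSpace ℝ (Fin d))) :=
  (prekopaLeindler_pi d).of_measurePreserving
    (WithLp.linearEquiv 2 ℝ (Fin d → ℝ)).symm.toLinearMap (PiLp.volume_preserving_toLp (Fin d))

theorem measurable_indicator_exp_neg_of_convexOn {d : ℕ} {D : Set (EuclideanSpace ℝ (Fin d))}
    {V : EuclideanSpace ℝ (Fin d) → ℝ} (hV : ConvexOn ℝ D V) :
    Measurable ((interior D).indicator fun x => ENNReal.ofReal (exp (-V x))) := by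
  classical
  have hcont : ContinuousOn (fun x => ENNReal.ofReal (exp (-V x))) (interior D) :=
    ENNReal.continuous_ofReal.comp_continuousOn
      (continuous_exp.comp_continuousOn hV.continuousOn_interior.neg)
  rw [← Set.piecewise_eq_indicator]
  exact hcont.measurable_piecewise continuousOn_const isOpen_interior.measurableSet

/-- Replacing the domain of the potential by its interior makes the density measurable. -/
theorem IsConvexMeasure.eq_withDensity_interior {d : ℕ} {μ : Measure (EuclideanSpace ℝ (Fin d))}
    (hμ : IsConvexMeasure μ) :
    ∃ (D : Set (EuclideanSpace ℝ (Fin d))) (V : EuclideanSpace ℝ (Fin d) → ℝ),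
      ConvexOn ℝ D V ∧
      μ = volume.withDensity ((interior D).indicator fun x => ENNReal.ofReal (exp (-V x))) := by
  obtain ⟨D, V, hD, hV, rfl⟩ := hμ
  refine ⟨D, V, hV, withDensity_congr_ae (indicator_ae_eq_of_ae_eq_set ?_)⟩
  have hfr : ∀ᵐ x ∂(volume : Measure (EuclideanSpace ℝ (Fin d))), x ∉ frontier D :=
    measure_eq_zero_iff_ae_notMem.1 (hD.addHaar_frontier volume)
  filter_upwards [hfr] with x hx
  refine propext ⟨fun hxD => ?_, fun hxD => interior_subset hxD⟩
  by_contra hxi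
  exact hx ⟨subset_closure hxD, hxi⟩

/-- **Borell's theorem**: a measure with log-concave density satisfies the multiplicative
Brunn–Minkowski inequality. -/
theorem IsConvexMeasure.rpow_mul_rpow_le {d : ℕ} {μ : Measure (EuclideanSpace ℝ (Fin d))}
    (hμ : IsConvexMeasure μ) {A B S : Set (EuclideanSpace ℝ (Fin d))} (hA : MeasurableSet A)
    (hB : MeasurableSet B) (hS : MeasurableSet S) {t s : ℝ} (ht : 0 < t) (hs : 0 < s)
    (hts : t + s = 1) (h : ∀ a ∈ A, ∀ b ∈ B, t • a + s • b ∈ S) :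
    μ A ^ t * μ B ^ s ≤ μ S := by
  obtain ⟨D, V, hV, rfl⟩ := hμ.eq_withDensity_interior
  have hρ := measurable_indicator_exp_neg_of_convexOn hV
  rw [withDensity_apply _ hA, withDensity_apply _ hB, withDensity_apply _ hS,
    ← lintegral_indicator hA, ← lintegral_indicator hB, ← lintegral_indicator hS]
  refine prekopaLeindler_euclideanSpace d _ _ _ (hρ.indicator hA) (hρ.indicator hB)
    (hρ.indicator hS) t s ht hs hts fun x y => ?_
  by_cases hx : x ∈ A ∩ interior D
  swap
  · have : A.indicator ((interior D).indicator fun x => ENNReal.ofReal (exp (-V x))) x = 0 := by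
      rw [indicator_indicator, indicator_of_notMem hx]
    simp [this, ht]
  by_cases hy : y ∈ B ∩ interior D
  swap
  · have : B.indicator ((interior D).indicator fun x => ENNReal.ofReal (exp (-V x))) y = 0 := by
      rw [indicator_indicator, indicator_of_notMem hy]
    simp [this, hs]
  have hz : t • x + s • y ∈ interior D := hV.1.interior hx.2 hy.2 ht.le hs.le hts
  rw [indicator_of_mem hx.1, indicator_of_mem hx.2, indicator_of_mem hy.1, indicator_of_mem hy.2,
    indicator_of_mem (h x hx.1 y hy.1), indicator_of_mem hz,
    ENNReal.ofReal_rpow_of_pos (exp_pos _), ENNReal.ofReal_rpow_of_pos (exp_pos _),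
    ← ENNReal.ofReal_mul (by positivity), ← exp_mul, ← exp_mul, ← exp_add]
  refine ENNReal.ofReal_le_ofReal (exp_le_exp.2 ?_)
  have := hV.2 (interior_subset hx.2) (interior_subset hy.2) ht.le hs.le hts
  simp only [smul_eq_mul] at this
  linarith

open scoped Pointwise in
/-- Borell's theorem for a set and the complement of its closed `h`-neighbourhood, each combined
with the ball of radius `r`: the two resulting sets are disjoint. -/
theorem IsConvexMeasure.ball_rpow_mul_add_le_one {d : ℕ}
    {μ : Measure (EuclideanSpace ℝ (Fin d))} [IsProbabilityMeasure μ] (hμ : IsConvexMeasure μ)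
    {A : Set (EuclideanSpace ℝ (Fin d))} (hA : MeasurableSet A) {r h : ℝ} (hr : 0 < r)
    (hh : 0 < h) :
    μ.real (Metric.closedBall 0 r) ^ (h / (h + 2 * r)) *
      (μ.real A ^ (2 * r / (h + 2 * r)) +
        (1 - μ.real (Metric.cthickening h A)) ^ (2 * r / (h + 2 * r))) ≤ 1 := by
  set t := 2 * r / (h + 2 * r) with ht_def
  set s := h / (h + 2 * r) with hs_def
  have ht : 0 < t := by positivity
  have hs : 0 < s := by positivity
  have hts : t + s = 1 := by rw [ht_def, hs_def]; field_simp; ring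
  have hsr : s / t * r = h / 2 := by rw [ht_def, hs_def]; field_simp
  set C := (Metric.cthickening h A)ᶜ with hC_def
  have hC_open : IsOpen C := Metric.isClosed_cthickening.isOpen_compl
  have hshift : ∀ b ∈ Metric.closedBall (0 : EuclideanSpace ℝ (Fin d)) r,
      ‖(s / t) • b‖ ≤ h / 2 := by
    intro b hb
    rw [mem_closedBall_zero_iff] at hb
    rw [norm_smul, Real.norm_of_nonneg (by positivity), ← hsr]
    gcongr
  have hcomb : ∀ a b : EuclideanSpace ℝ (Fin d), t • (a + (s / t) • b) = t • a + s • b := by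
    intro a b
    rw [smul_add, smul_smul, mul_div_cancel₀ _ ht.ne']
  set S := t • Metric.cthickening (h / 2) A with hS_def
  set T := t • (C + Metric.closedBall 0 (h / 2)) with hT_def
  have hS : MeasurableSet S := Metric.isClosed_cthickening.measurableSet.const_smul₀ t
  have hT : MeasurableSet T := hC_open.add_right.measurableSet.const_smul₀ t
  have hball : MeasurableSet (Metric.closedBall (0 : EuclideanSpace ℝ (Fin d)) r) :=
    measurableSet_closedBall
  have hAS := hμ.rpow_mul_rpow_le hA hball hS ht hs hts fun a ha b hb => by
    refine ⟨a + (s / t) • b, ?_, hcomb a b⟩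
    exact Metric.mem_cthickening_of_dist_le _ a _ _ ha (by simpa [dist_eq_norm] using hshift b hb)
  have hCT := hμ.rpow_mul_rpow_le hC_open.measurableSet hball hT ht hs hts fun a ha b hb =>
    ⟨a + (s / t) • b, ⟨a, ha, (s / t) • b, by simpa using hshift b hb, rfl⟩, hcomb a b⟩
  have hdisj : Disjoint S T := by
    refine Set.disjoint_left.2 ?_
    rintro _ ⟨x, hx, rfl⟩ ⟨_, ⟨c, hc, v, hv, rfl⟩, hxy⟩
    have hxy' : c + v = x := smul_right_injective _ ht.ne' hxy
    refine hc ?_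
    have hmem : c ∈ Metric.cthickening (h / 2) (Metric.cthickening (h / 2) A) :=
      Metric.mem_cthickening_of_dist_le _ x _ _ hx (by
        rw [← hxy']
        simpa using hv)
    simpa using Metric.cthickening_cthickening_subset (by positivity) (by positivity) A hmem
  have hsum : μ.real S + μ.real T ≤ 1 := by
    rw [← measureReal_union hdisj hT]
    exact measureReal_le_one
  have hAS' : μ.real A ^ t * μ.real (Metric.closedBall 0 r) ^ s ≤ μ.real S := by
    simpa [Measure.real, ENNReal.toReal_mul, ENNReal.toReal_rpow] using
      ENNReal.toReal_mono (measure_ne_top μ S) hAS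
  have hCT' : μ.real C ^ t * μ.real (Metric.closedBall 0 r) ^ s ≤ μ.real T := by
    simpa [Measure.real, ENNReal.toReal_mul, ENNReal.toReal_rpow] using
      ENNReal.toReal_mono (measure_ne_top μ T) hCT
  rw [hC_def, probReal_compl_eq_one_sub Metric.isClosed_cthickening.measurableSet] at hCT'
  linarith

theorem one_add_mul_log_le_rpow {x : ℝ} (hx : 0 < x) (s : ℝ) : 1 + s * log x ≤ x ^ s := by
  rw [rpow_def_of_pos hx]
  linarith [add_one_le_exp (log x * s)]

theorem add_mul_negMulLog_le_rpow {x t s : ℝ} (hx : 0 ≤ x) (ht : 0 < t) (hts : t + s = 1) :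
    x + s * negMulLog x ≤ x ^ t := by
  rcases hx.eq_or_lt with rfl | hx
  · simp [ht.ne']
  have h₁ := one_add_mul_log_le_rpow hx (-s)
  have h₂ : x ^ t = x * x ^ (-s) := by
    rw [show t = 1 + -s by linarith, rpow_add hx, rpow_one]
  rw [h₂, negMulLog]
  nlinarith

theorem IsConvexMeasure.entropy_sub_le {d : ℕ}
    {μ : Measure (EuclideanSpace ℝ (Fin d))} [IsProbabilityMeasure μ] (hμ : IsConvexMeasure μ)
    {A : Set (EuclideanSpace ℝ (Fin d))} (hA : MeasurableSet A) {r h : ℝ} (hr : 0 < r)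
    (hball : 0 < μ.real (Metric.closedBall 0 r)) (hh : 0 < h) :
    negMulLog (μ.real A) + negMulLog (1 - μ.real (Metric.cthickening h A)) +
      log (μ.real (Metric.closedBall 0 r)) *
        (1 - (μ.real (Metric.cthickening h A) - μ.real A) + h / (h + 2 * r) *
          (negMulLog (μ.real A) + negMulLog (1 - μ.real (Metric.cthickening h A)))) ≤
      (μ.real (Metric.cthickening h A) - μ.real A) / h * (h + 2 * r) := by
  have key := hμ.ball_rpow_mul_add_le_one hA hr hh
  set p := μ.real A
  set q := μ.real (Metric.cthickening h A)
  set b := μ.real (Metric.closedBall 0 r)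
  set s := h / (h + 2 * r) with hs_def
  have hs : 0 < s := by positivity
  have ht : 0 < 2 * r / (h + 2 * r) := by positivity
  have hts : 2 * r / (h + 2 * r) + s = 1 := by rw [hs_def]; field_simp; ring
  have hp₀ : 0 ≤ p := measureReal_nonneg
  have hp₁ : p ≤ 1 := measureReal_le_one
  have hq₀ : 0 ≤ q := measureReal_nonneg
  have hq₁ : q ≤ 1 := measureReal_le_one
  have hp := add_mul_negMulLog_le_rpow hp₀ ht hts
  have hq := add_mul_negMulLog_le_rpow (sub_nonneg.2 hq₁) ht hts
  have hb := one_add_mul_log_le_rpow hball s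
  set H₁ := negMulLog p
  set H₂ := negMulLog (1 - q)
  have hH₁ : 0 ≤ H₁ := negMulLog_nonneg hp₀ hp₁
  have hH₂ : 0 ≤ H₂ := negMulLog_nonneg (by linarith) (by linarith)
  have hY : 0 ≤ p + (1 - q) + s * (H₁ + H₂) := by
    have := mul_nonneg hs.le (add_nonneg hH₁ hH₂)
    linarith
  have hmain : (1 + s * log b) * (p + (1 - q) + s * (H₁ + H₂)) ≤ 1 :=
    calc _ ≤ b ^ s * (p + (1 - q) + s * (H₁ + H₂)) := by gcongr
      _ ≤ _ := by
        refine le_trans (mul_le_mul_of_nonneg_left ?_ (by positivity)) key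
        linarith
  have hdiv : (q - p) / h * (h + 2 * r) = (q - p) / s := by
    rw [hs_def]; field_simp
  rw [hdiv, le_div_iff₀ hs]
  nlinarith

/-- **Bobkov's isoperimetric inequality** for log-concave probability measures. -/
theorem IsConvexMeasure.entropy_add_log_ball_le {d : ℕ}
    {μ : Measure (EuclideanSpace ℝ (Fin d))} [IsProbabilityMeasure μ] (hμ : IsConvexMeasure μ)
    {A : Set (EuclideanSpace ℝ (Fin d))} (hA : MeasurableSet A) {r : ℝ} (hr : 0 < r)
    (hball : 0 < μ.real (Metric.closedBall 0 r)) (hσ : surfaceMeasure μ A ≠ 0) :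
    negMulLog (μ.real A) + negMulLog (1 - μ.real A) + log (μ.real (Metric.closedBall 0 r)) ≤
      2 * r * surfaceMeasure μ A := by
  set σ := surfaceMeasure μ A with hσ_def
  let D : ℝ → ℝ := fun h => (μ.real (Metric.cthickening h A) - μ.real A) / h
  have hσ_eq : σ = sSup {a | ∀ᶠ h in nhdsWithin 0 (Ioi 0), a ≤ D h} := liminf_eq
  have hbdd : BddAbove {a | ∀ᶠ h in nhdsWithin 0 (Ioi 0), a ≤ D h} := by
    by_contra hunb
    exact hσ (hσ_eq.trans (Real.sSup_of_not_bddAbove hunb))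
  have hη : ∀ c, σ < c → negMulLog (μ.real A) + negMulLog (1 - μ.real A) +
      log (μ.real (Metric.closedBall 0 r)) ≤ c * (2 * r) := by
    intro c hc
    have hfreq : ∃ᶠ h in nhdsWithin 0 (Ioi 0), D h < c := by
      intro hev
      have hmem : c ∈ {a | ∀ᶠ h in nhdsWithin 0 (Ioi 0), a ≤ D h} :=
        hev.mono fun h hh => not_lt.1 hh
      exact hc.not_ge (hσ_eq ▸ le_csSup hbdd hmem)
    set F := nhdsWithin (0 : ℝ) (Ioi 0) ⊓ 𝓟 {h | D h < c} with hF_def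
    have : F.NeBot := frequently_iff_neBot.1 hfreq
    have hF : F ≤ nhdsWithin 0 (Ioi 0) := inf_le_left
    have hF_lt : ∀ᶠ h in F, D h < c := mem_inf_of_right (mem_principal_self _)
    have hF_pos : ∀ᶠ h in F, 0 < h := hF self_mem_nhdsWithin
    have hid : Tendsto (fun h : ℝ => h) F (nhds 0) :=
      (tendsto_id.mono_left nhdsWithin_le_nhds).mono_left hF
    have hq : Tendsto (fun h => μ.real (Metric.cthickening h A)) F (nhds (μ.real A)) := by
      have hupper : Tendsto (fun h => μ.real A + c * h) F (nhds (μ.real A)) := by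
        simpa using (hid.const_mul c).const_add (μ.real A)
      refine tendsto_of_tendsto_of_tendsto_of_le_of_le' tendsto_const_nhds hupper
        (.of_forall fun h => measureReal_mono (Metric.self_subset_cthickening A)) ?_
      filter_upwards [hF_lt, hF_pos] with h hlt hpos
      have := (div_lt_iff₀ hpos).1 hlt
      linarith
    have hs : Tendsto (fun h : ℝ => h / (h + 2 * r)) F (nhds 0) := by
      simpa using! hid.div (hid.add_const (2 * r)) (by positivity)
    have hH₂ : Tendsto (fun h => negMulLog (1 - μ.real (Metric.cthickening h A))) F
        (nhds (negMulLog (1 - μ.real A))) :=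
      (continuous_negMulLog.tendsto _).comp (hq.const_sub 1)
    have hlhs := ((hH₂.const_add (negMulLog (μ.real A)))).add
      ((((hq.sub_const (μ.real A)).const_sub 1).add
        (hs.mul (hH₂.const_add (negMulLog (μ.real A))))).const_mul
          (log (μ.real (Metric.closedBall 0 r))))
    have hrhs : Tendsto (fun h => c * (h + 2 * r)) F (nhds (c * (2 * r))) := by
      simpa using (hid.add_const (2 * r)).const_mul c
    have hle := le_of_tendsto_of_tendsto hlhs hrhs (by
      filter_upwards [hF_lt, hF_pos] with h hlt hpos
      exact (hμ.entropy_sub_le hA hr hball hpos).trans (by gcongr))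
    simpa using hle
  have hlim : Tendsto (fun c : ℝ => c * (2 * r)) (nhdsWithin σ (Ioi σ)) (nhds (σ * (2 * r))) :=
    ((continuous_mul_const (2 * r)).tendsto σ).mono_left nhdsWithin_le_nhds
  rw [mul_comm (2 * r)]
  exact ge_of_tendsto hlim (eventually_nhdsWithin_of_forall hη)

theorem surfaceMeasure_nonneg {d : ℕ} (μ : Measure (EuclideanSpace ℝ (Fin d)))
    [IsFiniteMeasure μ] (A : Set (EuclideanSpace ℝ (Fin d))) : 0 ≤ surfaceMeasure μ A := by
  unfold surfaceMeasure
  rw [liminf_eq]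
  refine Real.sSup_nonneg' ⟨0, ?_, le_rfl⟩
  filter_upwards [self_mem_nhdsWithin] with h hh
  refine div_nonneg (sub_nonneg.2 ?_) (le_of_lt hh)
  exact measureReal_mono (μ := μ) (Metric.self_subset_cthickening A)

theorem neg_one_eighth_le_log {b : ℝ} (hb : 15 / 16 ≤ b) : -(1 / 8) ≤ log b := by
  have h₁ := one_sub_inv_le_log_of_pos (show 0 < b by linarith)
  have h₂ : b⁻¹ ≤ 16 / 15 := by
    rw [inv_le_comm₀ (by linarith) (by norm_num)]
    linarith
  linarith

theorem exists_closedBall_real_ge {d : ℕ} (μ : Measure (EuclideanSpace ℝ (Fin d)))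
    [IsProbabilityMeasure μ] {c : ℝ} (hc : c < 1) :
    ∃ r : ℝ, 0 < r ∧ c ≤ μ.real (Metric.closedBall 0 r) := by
  have hlim : Tendsto (fun n : ℕ => μ.real (Metric.closedBall 0 (n : ℝ))) atTop (nhds 1) := by
    have := tendsto_measure_iUnion_atTop (μ := μ)
      (s := fun n : ℕ => Metric.closedBall (0 : EuclideanSpace ℝ (Fin d)) (n : ℝ))
      fun m n hmn => Metric.closedBall_subset_closedBall (by exact_mod_cast hmn)
    rw [Metric.iUnion_closedBall_nat, measure_univ] at this
    exact (ENNReal.tendsto_toReal ENNReal.one_ne_top).comp this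
  obtain ⟨n, hn, hn₀⟩ := ((hlim.eventually (lt_mem_nhds hc)).and (eventually_gt_atTop 0)).exists
  exact ⟨n, by exact_mod_cast hn₀, hn.le⟩

/-- For sets of measure at most `1/4` whose complement has the measure of a ball `B_r`, Bobkov's
inequality is of logarithmic type with constant proportional to `r`. -/
theorem IsConvexMeasure.negMulLog_le_of_le_quarter {d : ℕ}
    {μ : Measure (EuclideanSpace ℝ (Fin d))} [IsProbabilityMeasure μ] (hμ : IsConvexMeasure μ)
    {A : Set (EuclideanSpace ℝ (Fin d))} (hA : MeasurableSet A) {r : ℝ} (hr : 0 < r)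
    (hAr : μ.real A = 1 - μ.real (Metric.closedBall 0 r)) (hA₄ : μ.real A ≤ 1 / 4)
    (hσ : surfaceMeasure μ A ≠ 0) :
    negMulLog (μ.real A) ≤ 4 * r * surfaceMeasure μ A := by
  have hball : μ.real (Metric.closedBall 0 r) = 1 - μ.real A := by linarith
  have key := hμ.entropy_add_log_ball_le hA hr (by rw [hball]; linarith) hσ
  rw [hball] at key
  have hp₀ : 0 ≤ μ.real A := measureReal_nonneg
  generalize μ.real A = p at *
  rcases hp₀.eq_or_lt with rfl | hp
  · have := surfaceMeasure_nonneg μ A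
    simp only [negMulLog_zero]
    positivity
  have hlog : log p ≤ 2 * log (1 - p) := by
    have h₁ : p ≤ (1 - p) ^ 2 := by nlinarith
    have h₂ := log_le_log hp h₁
    rwa [log_pow, Nat.cast_ofNat] at h₂
  simp only [negMulLog] at key ⊢
  nlinarith

theorem IsConvexMeasure.one_le_of_quarter_le {d : ℕ}
    {μ : Measure (EuclideanSpace ℝ (Fin d))} [IsProbabilityMeasure μ] (hμ : IsConvexMeasure μ)
    {A : Set (EuclideanSpace ℝ (Fin d))} (hA : MeasurableSet A) {r : ℝ} (hr : 0 < r)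
    (hball : 15 / 16 ≤ μ.real (Metric.closedBall 0 r)) (hA₄ : 1 / 4 ≤ μ.real A)
    (hA₂ : μ.real A ≤ 1 / 2) (hσ : surfaceMeasure μ A ≠ 0) :
    1 ≤ 8 * r * surfaceMeasure μ A := by
  have key := hμ.entropy_add_log_ball_le hA hr (by linarith) hσ
  have hlog := neg_one_eighth_le_log hball
  generalize μ.real A = p at *
  have h₁ := log_le_sub_one_of_pos (show 0 < p by linarith)
  have h₂ := log_le_sub_one_of_pos (show 0 < 1 - p by linarith)
  simp only [negMulLog] at key
  nlinarith

theorem stmt14 {d : ℕ} (μ : Measure (EuclideanSpace ℝ (Fin d))) [IsProbabilityMeasure μ]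
    (hμ : IsConvexMeasure μ) (hzero : (0 : EuclideanSpace ℝ (Fin d)) ∈ msupport μ)
    (R : ℝ) (hR : 0 < R)
    (hRdef : (μ (Metric.closedBall 0 R)).toReal = 1 / 2) :
    ∃ M : ℝ, ∀ r : ℝ, R ≤ r → isoF μ Real.log r / r ≤ M := by
  obtain ⟨r', hr', hball'⟩ := exists_closedBall_real_ge μ (c := 15 / 16) (by norm_num)
  refine ⟨4 + 8 * r' / R, fun r hRr => ?_⟩
  have hr : 0 < r := hR.trans_le hRr
  rw [div_le_iff₀ hr]
  refine Real.sSup_le ?_ (by positivity)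
  rintro _ ⟨A, hA, hAr, rfl⟩
  rw [one_div, log_inv, mul_neg, ← neg_mul, ← negMulLog]
  change negMulLog (μ.real A) / _ ≤ _
  change μ.real A = 1 - μ.real _ at hAr
  have hbound : 4 * r + 8 * r' ≤ (4 + 8 * r' / R) * r := by
    have : 8 * r' ≤ 8 * r' / R * r := by
      rw [div_mul_eq_mul_div, le_div_iff₀ hR]
      gcongr
    linarith
  refine le_trans ?_ hbound
  rcases eq_or_ne (surfaceMeasure μ A) 0 with hσ | hσ
  · rw [hσ, div_zero]
    positivity
  have hσ_pos : 0 < surfaceMeasure μ A := (surfaceMeasure_nonneg μ A).lt_of_ne' hσ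
  rw [div_le_iff₀ hσ_pos]
  rcases le_total (μ.real A) (1 / 4) with hA₄ | hA₄
  · have := hμ.negMulLog_le_of_le_quarter hA hr hAr hA₄ hσ
    nlinarith [mul_pos hr' hσ_pos]
  · have hball : 1 / 2 ≤ μ.real (Metric.closedBall 0 r) :=
      hRdef.symm.le.trans (measureReal_mono (Metric.closedBall_subset_closedBall hRr))
    have hσ_ge := hμ.one_le_of_quarter_le hA hr' hball' hA₄ (by linarith) hσ
    have hH : negMulLog (μ.real A) ≤ 1 := by
      have := one_sub_inv_le_log_of_pos (show 0 < μ.real A by linarith)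
      have hinv : μ.real A * (μ.real A)⁻¹ = 1 := mul_inv_cancel₀ (by linarith)
      rw [negMulLog]
      nlinarith
    nlinarith [mul_pos hr hσ_pos]
end
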